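/- Let 𝒞 be a set of continuous cost functions that is closed under composition and consistent for weighted resource graph games. Then for every c ∈ 𝒞 with c : ℝ_{≥0}^m → ℝ^m and all r, s ∈ {1,…,m} with r ≠ s, there exists a_{r,s} ∈ ℝ with a_{r,s} = a_{s,r} such that c_r(z + λ·1_s) − c_r(z) = a_{r,s} λ for all z ∈ ℝ_{≥0}^m with z_r > 0 and all λ ≥ 0. Moreover, if it is not the case that for every S ⊆ {1,…,m} and z ∈ ℝ_{≥0}^m the function λ ↦ Σ_{r∈S} c_r(z + λ·1_S) is affine in λ on λ ≥ 0, then a_{r,s} = 0 for all r, s. -/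

import Mathlib

open Finset NNReal

/-- The indicator vector of a set `S` of resources, as a vector of nonnegative reals. -/
def nindicVec {m : ℕ} (S : Finset (Fin m)) : Fin m → NNReal :=
  fun r => if r ∈ S then 1 else 0

/-- The load vector induced by weights `w` and a profile `y` of `0/1`-vectors. -/
def wloadVec {n m : ℕ} (w : Fin n → NNReal) (y : Fin n → Fin m → ℕ) : Fin m → NNReal :=
  fun r => ∑ i, w i * (y i r : NNReal)

/-- The private cost of player `i` in the weighted resource graph game. -/
noncomputable def wPlayerCost {n m : ℕ} (c : (Fin m → NNReal) → Fin m → ℝ)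
    (w : Fin n → NNReal) (y : Fin n → Fin m → ℕ) (i : Fin n) : ℝ :=
  ∑ r, ((w i : ℝ) * (y i r : ℝ)) * c (wloadVec w y) r

/-- `Y` is a valid system of strategy sets: each `Y i` is a nonempty
finite set of `0/1`-vectors. -/
def IsStrategySets {n m : ℕ} (Y : Fin n → Finset (Fin m → ℕ)) : Prop :=
  (∀ i, (Y i).Nonempty) ∧ ∀ i, ∀ v ∈ Y i, ∀ r, v r ≤ 1

/-- `y` is a pure Nash equilibrium of the weighted resource graph game with
weights `w`, strategy sets `Y`, and cost function `c`. -/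
def IsWPNE {n m : ℕ} (c : (Fin m → NNReal) → Fin m → ℝ) (w : Fin n → NNReal)
    (Y : Fin n → Finset (Fin m → ℕ)) (y : Fin n → Fin m → ℕ) : Prop :=
  (∀ i, y i ∈ Y i) ∧
    ∀ i, ∀ y' ∈ Y i,
      wPlayerCost c w y i ≤ wPlayerCost c w (Function.update y i y') i

/-- The composition `c ⊕ c'` of two cost functions. -/
def woplus {m m' : ℕ} (c : (Fin m → NNReal) → Fin m → ℝ)
    (c' : (Fin m' → NNReal) → Fin m' → ℝ) :
    (Fin (m + m') → NNReal) → Fin (m + m') → ℝ :=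
  fun x => Fin.addCases (motive := fun _ => ℝ)
    (fun i => c (fun j => x (Fin.castAdd m' j)) i)
    (fun i => c' (fun j => x (Fin.natAdd m j)) i)

/-- A set of cost functions on the nonnegative orthant, one set for each number
`m` of resources. -/
abbrev WCostFamily := (m : ℕ) → Set ((Fin m → NNReal) → Fin m → ℝ)

/-- `𝒞` is closed under composition. -/
def WClosedUnderComposition (𝒞 : WCostFamily) : Prop :=
  ∀ m m' : ℕ, ∀ c ∈ 𝒞 m, ∀ c' ∈ 𝒞 m', woplus c c' ∈ 𝒞 (m + m')

/-- `𝒞` is consistent for weighted resource graph games: every weighted resource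
graph game whose cost function belongs to `𝒞` has a pure Nash equilibrium. -/
def WConsistent (𝒞 : WCostFamily) : Prop :=
  ∀ m : ℕ, ∀ c ∈ 𝒞 m, ∀ n : ℕ, ∀ w : Fin n → NNReal, (∀ i, 0 < w i) →
    ∀ Y : Fin n → Finset (Fin m → ℕ), IsStrategySets Y →
      ∃ y, IsWPNE c w Y y

/-- The load vector when two players with weights `w₁` and `w₂` play `p` and `q` on top of
the base load `z`. -/
def pairLoad {m : ℕ} (z : Fin m → NNReal) (w₁ w₂ : NNReal) (p q : Fin m → ℕ) :
    Fin m → NNReal :=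
  fun r => z r + w₁ * (p r : NNReal) + w₂ * (q r : NNReal)

/-- The strategies of auxiliary players, one for each resource, producing the base load `z`. -/
noncomputable def baseStrategy {m : ℕ} (z : Fin m → NNReal) (r : Fin m) : Fin m → ℕ :=
  fun t => if z r ≠ 0 ∧ t = r then 1 else 0

/-- The weights of two players together with the auxiliary players producing the load `z`. -/
noncomputable def gadgetWeight {m : ℕ} (z : Fin m → NNReal) (w₁ w₂ : NNReal) :
    Fin (m + 2) → NNReal :=
  Matrix.vecCons w₁ (Matrix.vecCons w₂ fun r => if z r = 0 then 1 else z r)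

lemma wloadVec_gadgetWeight {m : ℕ} (z : Fin m → NNReal) (w₁ w₂ : NNReal)
    (y : Fin (m + 2) → Fin m → ℕ) (hy : ∀ r : Fin m, y r.succ.succ = baseStrategy z r) :
    wloadVec (gadgetWeight z w₁ w₂) y = pairLoad z w₁ w₂ (y 0) (y 1) := by
  ext1 t
  have h : ∑ r : Fin m, (if z r = 0 then 1 else z r) * (baseStrategy z r t : NNReal) = z t := by
    rw [Finset.sum_eq_single t]
    · by_cases h0 : z t = 0 <;> simp [baseStrategy, h0]
    · intro b _ hb
      simp [baseStrategy, hb.symm]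
    · simp
  simp only [wloadVec, pairLoad, gadgetWeight, Fin.sum_univ_succ, hy, Matrix.cons_val_succ,
    Matrix.cons_val_zero, h]
  simp only [Fin.succ_zero_eq_one]
  ring

/-- `d` is the pair of extra costs of a game in which two players with weights `w₁` and `w₂`
choose between two strategies each: player `k` pays (per unit of weight) an amount `d.k` more
when both players make the same choice than when they make different choices. -/
def HasInteraction (𝒞 : WCostFamily) (w₁ w₂ : NNReal) (d : ℝ × ℝ) : Prop :=
  ∃ m : ℕ, ∃ c ∈ 𝒞 m, ∃ (z : Fin m → NNReal) (p q : Bool → Fin m → ℕ) (k : ℝ × ℝ),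
    (∀ b r, p b r ≤ 1) ∧ (∀ b r, q b r ≤ 1) ∧ ∀ i j,
      ∑ r, (p i r : ℝ) * c (pairLoad z w₁ w₂ (p i) (q j)) r
          = k.1 + (if i = j then d.1 else 0) ∧
      ∑ r, (q j r : ℝ) * c (pairLoad z w₁ w₂ (p i) (q j)) r
          = k.2 + (if i = j then d.2 else 0)

lemma HasInteraction.not_opposite {𝒞 : WCostFamily} (hcons : WConsistent 𝒞) {w₁ w₂ : NNReal}
    (h₁ : 0 < w₁) (h₂ : 0 < w₂) {d : ℝ × ℝ} (hd : HasInteraction 𝒞 w₁ w₂ d) :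
    ¬ (0 < d.1 ∧ d.2 < 0) := by
  rintro ⟨hd1, hd2⟩
  obtain ⟨m, c, hc, z, p, q, k, hp, hq, H⟩ := hd
  have hw : ∀ i, 0 < gadgetWeight z w₁ w₂ i := by
    intro i
    refine Fin.cases ?_ (fun i => Fin.cases ?_ (fun r => ?_) i) i
    · simpa [gadgetWeight] using h₁
    · simpa [gadgetWeight] using h₂
    · by_cases h0 : z r = 0
      · simp [gadgetWeight, h0]
      · simpa [gadgetWeight, h0] using pos_iff_ne_zero.2 h0
  let Y : Fin (m + 2) → Finset (Fin m → ℕ) :=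
    Matrix.vecCons {p true, p false} (Matrix.vecCons {q true, q false} fun r => {baseStrategy z r})
  have hY : IsStrategySets Y := by
    constructor
    · intro i
      refine Fin.cases ?_ (fun i => Fin.cases ?_ (fun r => ?_) i) i <;> simp [Y]
    · intro i
      refine Fin.cases ?_ (fun i => Fin.cases ?_ (fun r => ?_) i) i
      · simp [Y, hp]
      · simp [Y, hq]
      · simp only [Y, Matrix.cons_val_succ, Finset.mem_singleton, forall_eq, baseStrategy]
        intro t
        split_ifs <;> simp
  obtain ⟨y, hyY, hy⟩ := hcons m c hc (m + 2) _ hw Y hY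
  have hybase : ∀ r : Fin m, y r.succ.succ = baseStrategy z r := fun r => by
    simpa [Y] using hyY r.succ.succ
  obtain ⟨i, hi⟩ : ∃ i, y 0 = p i := by
    have := hyY 0
    simp only [Y, Matrix.cons_val_zero, Finset.mem_insert, Finset.mem_singleton] at this
    exact this.elim (fun h => ⟨_, h⟩) (fun h => ⟨_, h⟩)
  obtain ⟨j, hj⟩ : ∃ j, y 1 = q j := by
    have := hyY 1
    simp only [Y, Matrix.cons_val_one, Matrix.cons_val_zero, Finset.mem_insert,
      Finset.mem_singleton] at this
    exact this.elim (fun h => ⟨_, h⟩) (fun h => ⟨_, h⟩)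
  have cost0 : ∀ y : Fin (m + 2) → Fin m → ℕ, (∀ r : Fin m, y r.succ.succ = baseStrategy z r) →
      wPlayerCost c (gadgetWeight z w₁ w₂) y 0
        = w₁ * ∑ r, (y 0 r : ℝ) * c (pairLoad z w₁ w₂ (y 0) (y 1)) r := by
    intro y hy
    simp only [wPlayerCost, wloadVec_gadgetWeight z w₁ w₂ y hy]
    simp [gadgetWeight, Finset.mul_sum, mul_assoc]
  have cost1 : ∀ y : Fin (m + 2) → Fin m → ℕ, (∀ r : Fin m, y r.succ.succ = baseStrategy z r) →
      wPlayerCost c (gadgetWeight z w₁ w₂) y 1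
        = w₂ * ∑ r, (y 1 r : ℝ) * c (pairLoad z w₁ w₂ (y 0) (y 1)) r := by
    intro y hy
    simp only [wPlayerCost, wloadVec_gadgetWeight z w₁ w₂ y hy]
    simp [gadgetWeight, Finset.mul_sum, mul_assoc]
  have e0 := hy 0 (p (!i)) (by cases i <;> simp [Y])
  have e1 := hy 1 (q (!j)) (by cases j <;> simp [Y])
  have ne0 : ∀ r : Fin m, r.succ.succ ≠ (0 : Fin (m + 2)) := fun r => Fin.succ_ne_zero _
  have ne1 : ∀ r : Fin m, r.succ.succ ≠ (1 : Fin (m + 2)) := fun r h => by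
    simp [Fin.ext_iff] at h
  have ne01 : (1 : Fin (m + 2)) ≠ 0 := by simp
  rw [cost0 y hybase, cost0 _ (fun r => by rw [Function.update_of_ne (ne0 r), hybase]),
    Function.update_self, Function.update_of_ne ne01, hi, hj, (H _ _).1, (H _ _).1] at e0
  rw [cost1 y hybase, cost1 _ (fun r => by rw [Function.update_of_ne (ne1 r), hybase]),
    Function.update_self, Function.update_of_ne ne01.symm, hi, hj, (H _ _).2, (H _ _).2] at e1
  have e0' := le_of_mul_le_mul_left e0 (by exact_mod_cast h₁)
  have e1' := le_of_mul_le_mul_left e1 (by exact_mod_cast h₂)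
  cases i <;> cases j <;> simp at e0' e1' <;> linarith

lemma HasInteraction.neg {𝒞 : WCostFamily} {w₁ w₂ : NNReal} {d : ℝ × ℝ}
    (hd : HasInteraction 𝒞 w₁ w₂ d) : HasInteraction 𝒞 w₁ w₂ (-d) := by
  obtain ⟨m, c, hc, z, p, q, k, hp, hq, H⟩ := hd
  refine ⟨m, c, hc, z, p, fun b => q (!b), k + d, hp, fun b => hq _, fun i j => ?_⟩
  rw [(H i (!j)).1, (H i (!j)).2]
  cases i <;> cases j <;> simp

lemma pairLoad_append {m m' : ℕ} (z : Fin m → NNReal) (z' : Fin m' → NNReal) (w₁ w₂ : NNReal)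
    (p q : Fin m → ℕ) (p' q' : Fin m' → ℕ) :
    pairLoad (Fin.append z z') w₁ w₂ (Fin.append p p') (Fin.append q q')
      = Fin.append (pairLoad z w₁ w₂ p q) (pairLoad z' w₁ w₂ p' q') := by
  ext r
  refine Fin.addCases (fun r => ?_) (fun r => ?_) r <;> simp [pairLoad]

lemma sum_append_mul_woplus {m m' : ℕ} (c : (Fin m → NNReal) → Fin m → ℝ)
    (c' : (Fin m' → NNReal) → Fin m' → ℝ) (p : Fin m → ℕ) (p' : Fin m' → ℕ)
    (x : Fin m → NNReal) (x' : Fin m' → NNReal) :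
    ∑ r, ((Fin.append p p' r : ℕ) : ℝ) * woplus c c' (Fin.append x x') r
      = ∑ r, (p r : ℝ) * c x r + ∑ r, (p' r : ℝ) * c' x' r := by
  simp [Fin.sum_univ_add, woplus]

lemma append_le_one {m m' : ℕ} {p : Fin m → ℕ} {p' : Fin m' → ℕ} (hp : ∀ r, p r ≤ 1)
    (hp' : ∀ r, p' r ≤ 1) (r : Fin (m + m')) : Fin.append p p' r ≤ 1 := by
  refine Fin.addCases (fun r => ?_) (fun r => ?_) r <;> simp [hp, hp']

lemma HasInteraction.add {𝒞 : WCostFamily} (hcomp : WClosedUnderComposition 𝒞)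
    {w₁ w₂ : NNReal} {d d' : ℝ × ℝ} (hd : HasInteraction 𝒞 w₁ w₂ d)
    (hd' : HasInteraction 𝒞 w₁ w₂ d') : HasInteraction 𝒞 w₁ w₂ (d + d') := by
  obtain ⟨m, c, hc, z, p, q, k, hp, hq, H⟩ := hd
  obtain ⟨m', c', hc', z', p', q', k', hp', hq', H'⟩ := hd'
  refine ⟨m + m', _, hcomp m m' c hc c' hc', Fin.append z z', fun b => Fin.append (p b) (p' b),
    fun b => Fin.append (q b) (q' b), k + k', fun b => append_le_one (hp b) (hp' b),
    fun b => append_le_one (hq b) (hq' b), fun i j => ?_⟩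
  dsimp only
  rw [pairLoad_append, sum_append_mul_woplus, sum_append_mul_woplus, (H i j).1, (H i j).2,
    (H' i j).1, (H' i j).2]
  cases i <;> cases j <;> simp <;> constructor <;> ring

/-- The pairs of extra costs form a subgroup of the plane. -/
def interactionGroup (𝒞 : WCostFamily) (hcomp : WClosedUnderComposition 𝒞)
    (hne : ∃ m, (𝒞 m).Nonempty) (w₁ w₂ : NNReal) : AddSubgroup (ℝ × ℝ) where
  carrier := {d | HasInteraction 𝒞 w₁ w₂ d}
  add_mem' := fun h h' => HasInteraction.add hcomp h h'
  neg_mem' := fun h => HasInteraction.neg h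
  zero_mem' := by
    obtain ⟨m, c, hc⟩ := hne
    exact ⟨m, c, hc, 0, 0, 0, 0, by simp, by simp, by simp⟩

lemma pairLoad_indicator {m : ℕ} (z : Fin m → NNReal) (w₁ w₂ : NNReal) (S T : Finset (Fin m)) :
    pairLoad z w₁ w₂ (fun r => if r ∈ S then 1 else 0) (fun r => if r ∈ T then 1 else 0)
      = z + w₁ • nindicVec S + w₂ • nindicVec T := by
  ext r
  simp [pairLoad, nindicVec]

lemma hasInteraction_of_mem {𝒞 : WCostFamily} (hcomp : WClosedUnderComposition 𝒞)
    {m : ℕ} {c : (Fin m → NNReal) → Fin m → ℝ} (hc : c ∈ 𝒞 m) (w₁ w₂ : NNReal)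
    (z : Fin m → NNReal) (S T : Finset (Fin m)) :
    HasInteraction 𝒞 w₁ w₂
      (∑ r ∈ S, c (z + w₁ • nindicVec S + w₂ • nindicVec T) r
          - ∑ r ∈ S, c (z + w₁ • nindicVec S) r,
        ∑ r ∈ T, c (z + w₁ • nindicVec S + w₂ • nindicVec T) r
          - ∑ r ∈ T, c (z + w₂ • nindicVec T) r) := by
  let v : Finset (Fin m) → Fin m → ℕ := fun S r => if r ∈ S then 1 else 0
  have hv : ∀ S r, v S r ≤ 1 := fun S r => by
    simp only [v]; split_ifs <;> simp
  have hz : ∀ r : Fin m, (0 : Fin m → ℕ) r ≤ 1 := by simp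
  have h0 : (0 : Fin m → ℕ) = v ∅ := by ext; simp [v]
  have hn : nindicVec (∅ : Finset (Fin m)) = 0 := by ext; simp [nindicVec]
  have hsum : ∀ (S : Finset (Fin m)) (g : Fin m → ℝ), ∑ r, (v S r : ℝ) * g r = ∑ r ∈ S, g r := by
    intro S g
    simp [v]
  refine ⟨m + m, _, hcomp m m c hc c hc, Fin.append z z,
    fun b => if b then Fin.append (v S) 0 else Fin.append 0 (v S),
    fun b => if b then Fin.append (v T) 0 else Fin.append 0 (v T),
    (∑ r ∈ S, c (z + w₁ • nindicVec S) r, ∑ r ∈ T, c (z + w₂ • nindicVec T) r), ?_, ?_, ?_⟩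
  · rintro (_ | _)
    exacts [append_le_one hz (hv S), append_le_one (hv S) hz]
  · rintro (_ | _)
    exacts [append_le_one hz (hv T), append_le_one (hv T) hz]
  · have hl := fun S T => pairLoad_indicator z w₁ w₂ S T
    change ∀ S T, pairLoad z w₁ w₂ (v S) (v T) = _ at hl
    rintro (_ | _) (_ | _) <;>
      simp [h0, pairLoad_append, sum_append_mul_woplus, hsum, hl, hn]

lemma equal_weight_identity {𝒞 : WCostFamily} (hcomp : WClosedUnderComposition 𝒞)
    (hcons : WConsistent 𝒞) {m : ℕ} {c : (Fin m → NNReal) → Fin m → ℝ} (hc : c ∈ 𝒞 m)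
    {w : NNReal} (hw : 0 < w) (z : Fin m → NNReal) (S T : Finset (Fin m)) :
    ∑ r ∈ S, c (z + w • nindicVec S + w • nindicVec T) r - ∑ r ∈ S, c (z + w • nindicVec S) r
      = ∑ r ∈ T, c (z + w • nindicVec S + w • nindicVec T) r
        - ∑ r ∈ T, c (z + w • nindicVec T) r := by
  have h₁ := hasInteraction_of_mem hcomp hc w w z S T
  have h₂ := hasInteraction_of_mem hcomp hc w w z T S
  have e : z + w • nindicVec T + w • nindicVec S = z + w • nindicVec S + w • nindicVec T := by
    abel
  rw [e] at h₂
  by_contra hne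
  have h := h₁.add hcomp h₂.neg
  have a := h.not_opposite hcons hw hw
  have b := h.neg.not_opposite hcons hw hw
  simp only [Prod.fst_add, Prod.snd_add, Prod.fst_neg, Prod.snd_neg] at a b
  rcases lt_or_gt_of_ne hne with hlt | hlt
  · exact b ⟨by linarith, by linarith⟩
  · exact a ⟨by linarith, by linarith⟩

/-- All interactions are parallel to any given nonzero one. -/
lemma HasInteraction.parallel {𝒞 : WCostFamily} (hcomp : WClosedUnderComposition 𝒞)
    (hcons : WConsistent 𝒞) (hne : ∃ m, (𝒞 m).Nonempty) {w₁ w₂ : NNReal} (h₁ : 0 < w₁)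
    (h₂ : 0 < w₂) {b t : ℝ} (hb : b ≠ 0) (ht : 0 < t)
    (hu : HasInteraction 𝒞 w₁ w₂ (b, t * b)) {d : ℝ × ℝ} (hd : HasInteraction 𝒞 w₁ w₂ d) :
    d.2 = t * d.1 := by
  let G := interactionGroup 𝒞 hcomp hne w₁ w₂
  have key : ∀ b : ℝ, 0 < b → (b, t * b) ∈ G → ∀ d ∈ G, t * d.1 ≤ d.2 := by
    intro b hb hu d hd
    by_contra! hlt
    obtain ⟨N, hN⟩ := exists_nat_gt (t * b / (t * d.1 - d.2))
    rw [div_lt_iff₀ (by linarith)] at hN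
    have hq₁ := Int.lt_floor_add_one (-(N * d.1) / b)
    have hq₂ := Int.floor_le (-(N * d.1) / b)
    set k := ⌊-(N * d.1) / b⌋
    rw [div_lt_iff₀ hb] at hq₁
    rw [le_div_iff₀ hb] at hq₂
    have hmem : (k + 1) • (b, t * b) + N • d ∈ G :=
      G.add_mem (G.zsmul_mem hu _) (G.nsmul_mem hd _)
    refine HasInteraction.not_opposite hcons h₁ h₂ hmem ⟨?_, ?_⟩
    · simp
      linarith
    · simp
      nlinarith [mul_le_mul_of_nonneg_left hq₂ ht.le]
  have key' : ∀ d ∈ G, t * d.1 ≤ d.2 := by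
    rcases lt_or_gt_of_ne hb with h | h
    · refine key (-b) (by linarith) ?_
      simpa using G.neg_mem hu
    · exact key b h hu
  have a := key' d hd
  have a' := key' (-d) (G.neg_mem hd)
  simp only [Prod.fst_neg, Prod.snd_neg] at a'
  linarith

lemma eq_mul_of_local_homogeneous {g : NNReal → ℝ} (hg : Continuous g) {δ : NNReal} (hδ : 0 < δ)
    (h : ∀ w, 0 < w → w ≤ δ → ∀ k : ℕ, g (k * w) = k * g w) (lam : NNReal) :
    g lam = lam * g 1 := by
  have hlim : Filter.Tendsto (fun n : ℕ => (⌊(lam : ℝ) * n⌋₊ : ℝ) / n) Filter.atTop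
      (nhds (lam : ℝ)) :=
    (tendsto_nat_floor_mul_div_atTop lam.2).comp tendsto_natCast_atTop_atTop
  have hlim' : Filter.Tendsto (fun n : ℕ => (⌊(lam : ℝ) * n⌋₊ : NNReal) * (n : NNReal)⁻¹)
      Filter.atTop (nhds lam) := by
    rw [← NNReal.tendsto_coe]
    simpa [div_eq_mul_inv] using hlim
  refine tendsto_nhds_unique (hg.continuousAt.tendsto.comp hlim')
    ((hlim.mul_const (g 1)).congr' ?_)
  obtain ⟨N, hN⟩ := exists_nat_gt δ⁻¹
  filter_upwards [Filter.eventually_ge_atTop (N + 1)] with n hn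
  have hn0 : (n : NNReal) ≠ 0 := by
    have : n ≠ 0 := by omega
    exact_mod_cast this
  have hn0' : (n : ℝ) ≠ 0 := by exact_mod_cast hn0
  have hle : (n : NNReal)⁻¹ ≤ δ := by
    refine inv_le_of_inv_le₀ hδ (hN.le.trans ?_)
    exact_mod_cast (by omega : N ≤ n)
  have hpos : 0 < (n : NNReal)⁻¹ := by positivity
  have h1 := h _ hpos hle n
  rw [mul_inv_cancel₀ hn0] at h1
  have h2 := h _ hpos hle ⌊(lam : ℝ) * n⌋₊
  simp only [Function.comp]
  rw [h2, h1]
  field_simp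

/-- A continuous function whose second differences away from zero vanish is affine. -/
lemma affine_of_second_difference {f : NNReal → ℝ} (hf : Continuous f)
    (h : ∀ x w : NNReal, 0 < w → w ≤ x → f (x + w + w) - f (x + w) = f (x + w) - f x)
    (lam : NNReal) : f lam = (f 1 - f 0) * lam + f 0 := by
  have hpos : ∀ x, 0 < x → ∀ lam, f (x + lam) - f x = lam * (f (x + 1) - f x) := by
    intro x hx
    refine eq_mul_of_local_homogeneous (g := fun lam => f (x + lam) - f x) (by fun_prop) hx ?_
    intro w hw hwx
    have hstep : ∀ k : ℕ, f (x + k * w + w) - f (x + k * w) = f (x + w) - f x := by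
      intro k
      induction k with
      | zero => simp
      | succ k ih =>
        have := h (x + k * w) w hw (hwx.trans le_self_add)
        have e : x + ((k + 1 : ℕ) : NNReal) * w = x + k * w + w := by push_cast; ring
        rw [e, this, ih]
    intro k
    induction k with
    | zero => simp
    | succ k ih =>
      have e : x + ((k + 1 : ℕ) : NNReal) * w = x + k * w + w := by push_cast; ring
      have := hstep k
      rw [e]
      push_cast
      linarith
  have hL : Filter.Tendsto (fun n : ℕ => ((n : NNReal) + 1)⁻¹) Filter.atTop (nhds 0) := by
    rw [← NNReal.tendsto_coe]
    simpa [one_div] using tendsto_one_div_add_atTop_nhds_zero_nat (𝕜 := ℝ)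
  have hA : Continuous fun x => f (x + lam) - f x := by fun_prop
  have hB : Continuous fun x => (lam : ℝ) * (f (x + 1) - f x) := by fun_prop
  have h0 := tendsto_nhds_unique ((hA.tendsto 0).comp hL)
    (((hB.tendsto 0).comp hL).congr fun n => (hpos _ (by positivity) lam).symm)
  simp only [zero_add] at h0
  linarith

lemma nindicVec_pair {m : ℕ} {r s : Fin m} (hrs : r ≠ s) :
    nindicVec {r, s} = nindicVec {r} + nindicVec {s} := by
  ext t
  by_cases h : t = r <;> by_cases h' : t = s <;> simp_all [nindicVec]

lemma exists_add_smul_nindicVec {m : ℕ} {x : Fin m → NNReal} {r : Fin m} {w : NNReal}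
    (h : w ≤ x r) : ∃ z, x = z + w • nindicVec {r} := by
  refine ⟨x - w • nindicVec {r}, (tsub_add_cancel_of_le fun t => ?_).symm⟩
  by_cases ht : t = r
  · subst ht; simpa [nindicVec] using h
  · simp [nindicVec, ht]

/-- The effect on the cost of resource `r` of raising the load of resource `s` by `w`. -/
def crossEffect {m : ℕ} (c : (Fin m → NNReal) → Fin m → ℝ) (r s : Fin m)
    (x : Fin m → NNReal) (w : NNReal) : ℝ :=
  c (x + w • nindicVec {s}) r - c x r

lemma crossEffect_comm_of_weight {𝒞 : WCostFamily}
    (hcomp : WClosedUnderComposition 𝒞) (hcons : WConsistent 𝒞) {m : ℕ}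
    {c : (Fin m → NNReal) → Fin m → ℝ} (hc : c ∈ 𝒞 m)
    {w : NNReal} (hw : 0 < w) (r s : Fin m) (z : Fin m → NNReal) :
    crossEffect c r s (z + w • nindicVec {r}) w = crossEffect c s r (z + w • nindicVec {s}) w := by
  have h := equal_weight_identity hcomp hcons hc hw z {r} {s}
  simpa [crossEffect, add_right_comm] using h

lemma crossEffect_step {𝒞 : WCostFamily}
    (hcomp : WClosedUnderComposition 𝒞) (hcons : WConsistent 𝒞) {m : ℕ}
    {c : (Fin m → NNReal) → Fin m → ℝ} (hc : c ∈ 𝒞 m)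
    {w : NNReal} (hw : 0 < w) {r s : Fin m} (hrs : r ≠ s)
    {x : Fin m → NNReal} (hx : w ≤ x r) :
    crossEffect c r s (x + w • nindicVec {s}) w = crossEffect c r s x w := by
  obtain ⟨z, rfl⟩ := exists_add_smul_nindicVec hx
  rw [crossEffect_comm_of_weight hcomp hcons hc hw r s z]
  have h := equal_weight_identity hcomp hcons hc hw z {r, s} {s}
  rw [nindicVec_pair hrs, Finset.sum_pair hrs, Finset.sum_pair hrs, Finset.sum_singleton,
    Finset.sum_singleton, smul_add] at h
  have e : z + w • nindicVec {s} + w • nindicVec {r}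
    = z + w • nindicVec {r} + w • nindicVec {s} := by abel
  simp only [crossEffect, e]
  simp only [← add_assoc] at h
  linarith

lemma crossEffect_eq_mul {𝒞 : WCostFamily}
    (hcont : ∀ m : ℕ, ∀ c ∈ 𝒞 m, Continuous c)
    (hcomp : WClosedUnderComposition 𝒞) (hcons : WConsistent 𝒞) {m : ℕ}
    {c : (Fin m → NNReal) → Fin m → ℝ} (hc : c ∈ 𝒞 m)
    {r s : Fin m} (hrs : r ≠ s) {x : Fin m → NNReal} (hx : 0 < x r)
    (lam : NNReal) : crossEffect c r s x lam = lam * crossEffect c r s x 1 := by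
  have hcc := hcont m c hc
  refine eq_mul_of_local_homogeneous (g := crossEffect c r s x) ?_ hx ?_ lam
  · unfold crossEffect
    fun_prop
  intro w hw hwx
  have hstep : ∀ k : ℕ, crossEffect c r s (x + (k * w) • nindicVec {s}) w
      = crossEffect c r s x w := by
    intro k
    induction k with
    | zero => simp
    | succ k ih =>
      have e : x + (((k + 1 : ℕ) : NNReal) * w) • nindicVec {s}
          = x + (k * w) • nindicVec {s} + w • nindicVec {s} := by
        push_cast; rw [add_mul, one_mul, add_smul, add_assoc]
      rw [e, crossEffect_step hcomp hcons hc hw hrs (hwx.trans (by simp)), ih]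
  intro k
  induction k with
  | zero => simp [crossEffect]
  | succ k ih =>
    have e : x + (((k + 1 : ℕ) : NNReal) * w) • nindicVec {s}
        = x + (k * w) • nindicVec {s} + w • nindicVec {s} := by
      push_cast; rw [add_mul, one_mul, add_smul, add_assoc]
    have := hstep k
    simp only [crossEffect] at this ih ⊢
    rw [e]
    push_cast
    linarith

lemma crossEffect_add_right {𝒞 : WCostFamily}
    (hcont : ∀ m : ℕ, ∀ c ∈ 𝒞 m, Continuous c)
    (hcomp : WClosedUnderComposition 𝒞) (hcons : WConsistent 𝒞) {m : ℕ}
    {c : (Fin m → NNReal) → Fin m → ℝ} (hc : c ∈ 𝒞 m)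
    {r s : Fin m} (hrs : r ≠ s) {x : Fin m → NNReal} (hx : 0 < x r)
    (lam : NNReal) :
    crossEffect c r s (x + lam • nindicVec {s}) 1 = crossEffect c r s x 1 := by
  have h₁ := crossEffect_eq_mul hcont hcomp hcons hc hrs hx lam
  have h₂ := crossEffect_eq_mul hcont hcomp hcons hc hrs hx (lam + 1)
  simp only [crossEffect, add_smul, ← add_assoc] at h₁ h₂ ⊢
  push_cast at h₂
  linarith

lemma crossEffect_comm {𝒞 : WCostFamily}
    (hcont : ∀ m : ℕ, ∀ c ∈ 𝒞 m, Continuous c)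
    (hcomp : WClosedUnderComposition 𝒞) (hcons : WConsistent 𝒞) {m : ℕ}
    {c : (Fin m → NNReal) → Fin m → ℝ} (hc : c ∈ 𝒞 m)
    {r s : Fin m} (hrs : r ≠ s) {x : Fin m → NNReal} (hr : 0 < x r)
    (hs : 0 < x s) : crossEffect c r s x 1 = crossEffect c s r x 1 := by
  set w := min (x r) (x s) with hw_def
  have hw : 0 < w := lt_min hr hs
  obtain ⟨y, hy⟩ := exists_add_smul_nindicVec (x := x) (r := r) (w := w) (min_le_left _ _)
  obtain ⟨z, hz⟩ := exists_add_smul_nindicVec (x := y) (r := s) (w := w) (by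
    have : x s = y s := by rw [hy]; simp [nindicVec, hrs.symm]
    rw [← this]
    exact min_le_right _ _)
  have h := crossEffect_comm_of_weight hcomp hcons hc hw r s z
  have hpr : 0 < (z + w • nindicVec {r}) r := by simp [nindicVec, hw]
  have hps : 0 < (z + w • nindicVec {s}) s := by simp [nindicVec, hw]
  rw [crossEffect_eq_mul hcont hcomp hcons hc hrs hpr,
    crossEffect_eq_mul hcont hcomp hcons hc hrs.symm hps] at h
  have h' := mul_left_cancel₀ (by exact_mod_cast hw.ne' : (w : ℝ) ≠ 0) h
  rw [← crossEffect_add_right hcont hcomp hcons hc hrs hpr w,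
    ← crossEffect_add_right hcont hcomp hcons hc hrs.symm hps w, add_right_comm] at h'
  rw [hy, hz]
  exact h'

lemma crossEffect_add_left {𝒞 : WCostFamily}
    (hcont : ∀ m : ℕ, ∀ c ∈ 𝒞 m, Continuous c)
    (hcomp : WClosedUnderComposition 𝒞) (hcons : WConsistent 𝒞) {m : ℕ}
    {c : (Fin m → NNReal) → Fin m → ℝ} (hc : c ∈ 𝒞 m)
    {r s : Fin m} (hrs : r ≠ s) {x : Fin m → NNReal} (hx : 0 < x r)
    (lam : NNReal) :
    crossEffect c r s (x + lam • nindicVec {r}) 1 = crossEffect c r s x 1 := by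
  have hr : 0 < (x + (1 : NNReal) • nindicVec {s}) r := by simp [hx]
  have hs : 0 < (x + (1 : NNReal) • nindicVec {s}) s := by simp [nindicVec]
  rw [← crossEffect_add_right hcont hcomp hcons hc hrs hx 1,
    crossEffect_comm hcont hcomp hcons hc hrs hr hs,
    ← crossEffect_add_right hcont hcomp hcons hc hrs.symm hs lam,
    ← crossEffect_comm hcont hcomp hcons hc hrs (by simp [hx]) (by simp [nindicVec]),
    add_right_comm, crossEffect_add_right hcont hcomp hcons hc hrs (by simp [hx])]

lemma crossEffect_add_other {𝒞 : WCostFamily}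
    (hcont : ∀ m : ℕ, ∀ c ∈ 𝒞 m, Continuous c)
    (hcomp : WClosedUnderComposition 𝒞) (hcons : WConsistent 𝒞) {m : ℕ}
    {c : (Fin m → NNReal) → Fin m → ℝ} (hc : c ∈ 𝒞 m)
    {r s t : Fin m} (hrs : r ≠ s) (hrt : r ≠ t) (hst : s ≠ t)
    {x : Fin m → NNReal} (hx : 0 < x r) (lam : NNReal) :
    crossEffect c r s (x + lam • nindicVec {t}) 1 = crossEffect c r s x 1 := by
  rcases eq_or_ne lam 0 with rfl | hlam
  · simp
  have hw : 0 < lam := pos_iff_ne_zero.2 hlam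
  have h := equal_weight_identity hcomp hcons hc hw x {r, t} {s}
  rw [nindicVec_pair hrt, Finset.sum_pair hrt, Finset.sum_pair hrt, Finset.sum_singleton,
    Finset.sum_singleton, smul_add] at h
  set R := lam • nindicVec {r} with hR
  set S := lam • nindicVec {s} with hS
  set T := lam • nindicVec {t} with hT
  have hRr : 0 < R r := by simp [hR, nindicVec, hw]
  have hSs : 0 < S s := by simp [hS, nindicVec, hw]
  have hTt : 0 < T t := by simp [hT, nindicVec, hw]
  have h' : crossEffect c r s (x + R + T) lam + crossEffect c t s (x + R + T) lam
      = crossEffect c s t (x + S + R) lam + crossEffect c s r (x + S) lam := by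
    have e : x + S + R + T = x + R + T + S := by abel
    simp only [crossEffect, ← hR, ← hS, ← hT, e]
    simp only [← add_assoc] at h
    linarith
  rw [crossEffect_eq_mul hcont hcomp hcons hc hrs (by simp [hx]),
    crossEffect_eq_mul hcont hcomp hcons hc hst.symm (by simp [hTt]),
    crossEffect_eq_mul hcont hcomp hcons hc hst (by simp [hSs]),
    crossEffect_eq_mul hcont hcomp hcons hc hrs.symm (by simp [hSs]),
    ← mul_add, ← mul_add] at h'
  have h₀ := mul_left_cancel₀ (by exact_mod_cast hlam : (lam : ℝ) ≠ 0) h'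
  have e₁ : crossEffect c t s (x + R + T) 1 = crossEffect c s t (x + S + R) 1 := by
    rw [← crossEffect_add_right hcont hcomp hcons hc hst.symm (by simp [hTt]) lam,
      ← crossEffect_add_right hcont hcomp hcons hc hst (by simp [hSs]) lam, ← hS, ← hT,
      crossEffect_comm hcont hcomp hcons hc hst.symm (by simp [hTt]) (by simp [hSs])]
    congr 1
    abel
  have e₂ : crossEffect c s r (x + S) 1 = crossEffect c r s x 1 := by
    rw [← crossEffect_comm hcont hcomp hcons hc hrs (by simp [hx]) (by simp [hSs]),
      crossEffect_add_right hcont hcomp hcons hc hrs hx]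
  have e₃ : crossEffect c r s (x + R + T) 1 = crossEffect c r s (x + T) 1 := by
    rw [add_right_comm, crossEffect_add_left hcont hcomp hcons hc hrs (by simp [hx])]
  linarith

lemma crossEffect_add {𝒞 : WCostFamily}
    (hcont : ∀ m : ℕ, ∀ c ∈ 𝒞 m, Continuous c)
    (hcomp : WClosedUnderComposition 𝒞) (hcons : WConsistent 𝒞) {m : ℕ}
    {c : (Fin m → NNReal) → Fin m → ℝ} (hc : c ∈ 𝒞 m)
    {r s : Fin m} (hrs : r ≠ s) {x : Fin m → NNReal} (hx : 0 < x r)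
    (y : Fin m → NNReal) : crossEffect c r s (x + y) 1 = crossEffect c r s x 1 := by
  have hy : y = ∑ t, y t • nindicVec {t} := by
    ext u
    simp [nindicVec, Finset.sum_apply]
  rw [hy]
  induction (Finset.univ : Finset (Fin m)) using Finset.induction_on with
  | empty => simp
  | insert t F ht ih =>
    rw [Finset.sum_insert ht, add_comm (y t • _), ← add_assoc, ← ih]
    have hpos : 0 < (x + ∑ t ∈ F, y t • nindicVec {t}) r := by simp [hx]
    by_cases htr : r = t
    · subst htr
      exact crossEffect_add_left hcont hcomp hcons hc hrs hpos _
    by_cases hts : s = t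
    · subst hts
      exact crossEffect_add_right hcont hcomp hcons hc hrs hpos _
    exact crossEffect_add_other hcont hcomp hcons hc hrs htr hts hpos _

lemma crossEffect_eq_one {𝒞 : WCostFamily}
    (hcont : ∀ m : ℕ, ∀ c ∈ 𝒞 m, Continuous c)
    (hcomp : WClosedUnderComposition 𝒞) (hcons : WConsistent 𝒞) {m : ℕ}
    {c : (Fin m → NNReal) → Fin m → ℝ} (hc : c ∈ 𝒞 m)
    {r s : Fin m} (hrs : r ≠ s) {x : Fin m → NNReal} (hx : 0 < x r) :
    crossEffect c r s x 1 = crossEffect c r s 1 1 := by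
  rw [← crossEffect_add hcont hcomp hcons hc hrs hx 1, add_comm,
    crossEffect_add hcont hcomp hcons hc hrs (by simp)]

lemma diagonal_affine_of_crossEffect_ne_zero {𝒞 : WCostFamily}
    (hcont : ∀ m : ℕ, ∀ c ∈ 𝒞 m, Continuous c)
    (hcomp : WClosedUnderComposition 𝒞) (hcons : WConsistent 𝒞) {m : ℕ}
    {c : (Fin m → NNReal) → Fin m → ℝ} (hc : c ∈ 𝒞 m)
    {r s : Fin m} (hrs : r ≠ s)
    (ha : crossEffect c r s 1 1 ≠ 0) (S : Finset (Fin m)) (z : Fin m → NNReal) :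
    ∃ a b : ℝ, ∀ lam : NNReal, ∑ r ∈ S, c (z + lam • nindicVec S) r = a * lam + b := by
  have hcc := hcont m c hc
  set f : NNReal → ℝ := fun lam => ∑ r ∈ S, c (z + lam • nindicVec S) r with hf
  have hfc : Continuous f := by
    simp only [hf]
    fun_prop
  refine ⟨f 1 - f 0, f 0, fun lam => affine_of_second_difference hfc ?_ lam⟩
  intro x w hw hwx
  obtain ⟨y, rfl⟩ := exists_add_of_le hwx
  have h2w : 0 < w + w := by positivity
  have hu := hasInteraction_of_mem hcomp hc (w + w) w 0 {r} {s}
  have hr : 0 < (0 + (w + w) • nindicVec {r} : Fin m → NNReal) r := by simp [nindicVec, hw]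
  have hs : 0 < (0 + w • nindicVec {s} : Fin m → NNReal) s := by simp [nindicVec, hw]
  have E₁ := crossEffect_eq_mul hcont hcomp hcons hc hrs hr w
  have E₂ := crossEffect_eq_mul hcont hcomp hcons hc hrs.symm hs (w + w)
  rw [crossEffect_eq_one hcont hcomp hcons hc hrs hr] at E₁
  rw [crossEffect_eq_one hcont hcomp hcons hc hrs.symm hs,
    ← crossEffect_comm hcont hcomp hcons hc hrs (by simp) (by simp)] at E₂
  simp only [crossEffect] at E₁ E₂
  rw [add_right_comm] at E₂
  simp only [Finset.sum_singleton] at hu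
  rw [E₁, E₂] at hu
  have hd := hasInteraction_of_mem hcomp hc (w + w) w (z + y • nindicVec S) S S
  have hb : (w : ℝ) * (c (1 + (1 : NNReal) • nindicVec {s}) r - c 1 r) ≠ 0 :=
    mul_ne_zero (by exact_mod_cast hw.ne') ha
  have h := HasInteraction.parallel hcomp hcons ⟨m, c, hc⟩ h2w hw hb (t := 2) two_pos
    (by convert hu using 2; push_cast; ring) hd
  have e : ∀ u v : NNReal, z + u • nindicVec S + v • nindicVec S = z + (u + v) • nindicVec S :=
    fun u v => by rw [add_assoc, add_smul]
  simp only [e] at h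
  have i₁ : y + (w + w) + w = w + y + w + w := by ring
  have i₂ : y + (w + w) = w + y + w := by ring
  have i₃ : y + w = w + y := by ring
  rw [i₁, i₂, i₃] at h
  simp only [hf]
  linarith

/-- Lemma: the influence of the load of resource `s` on the cost of resource `r` is
linear with symmetric coefficients; moreover, if the aggregated costs along diagonal
directions are not all affine, the coefficients vanish. -/
theorem weighted_linear_effect (𝒞 : WCostFamily)
    (hcont : ∀ m : ℕ, ∀ c ∈ 𝒞 m, Continuous c)
    (hcomp : WClosedUnderComposition 𝒞) (hcons : WConsistent 𝒞)
    (m : ℕ) (c : (Fin m → NNReal) → Fin m → ℝ) (hc : c ∈ 𝒞 m) :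
    ∃ a : Fin m → Fin m → ℝ, (∀ r s, a r s = a s r) ∧
      (∀ r s : Fin m, r ≠ s → ∀ z : Fin m → NNReal, 0 < z r → ∀ lam : NNReal,
        c (z + lam • nindicVec {s}) r - c z r = a r s * (lam : ℝ)) ∧
      ((¬ ∀ S : Finset (Fin m), ∀ z : Fin m → NNReal, ∃ a' b' : ℝ,
          ∀ lam : NNReal, ∑ r ∈ S, c (z + lam • nindicVec S) r = a' * (lam : ℝ) + b') →
        ∀ r s : Fin m, a r s = 0) := by
  refine ⟨fun r s => if r = s then 0 else crossEffect c r s 1 1, fun r s => ?_, ?_, ?_⟩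
  · by_cases hrs : r = s
    · simp [hrs]
    · simp only [hrs, Ne.symm hrs, if_false]
      exact crossEffect_comm hcont hcomp hcons hc hrs (by simp) (by simp)
  · intro r s hrs z hz lam
    have h := crossEffect_eq_mul hcont hcomp hcons hc hrs hz lam
    rw [crossEffect_eq_one hcont hcomp hcons hc hrs hz] at h
    simp only [hrs, if_false]
    rw [mul_comm, ← h, crossEffect]
  · intro hna r s
    by_contra ha
    by_cases hrs : r = s
    · simp [hrs] at ha
    · simp only [hrs, if_false] at ha
      exact hna (diagonal_affine_of_crossEffect_ne_zero hcont hcomp hcons hc hrs ha)
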